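/- arXiv:2012.12982 — 8 statements merged into one kernel-verified Lean document; each statement's English description precedes it below -/
import Mathlib

section
/- Let L(M) be the L-transform of an HMS model M. Then each map π_a of L(M) satisfies property (D): for every world w_X in the restriction lattice of L(M), π_a(w_X) = w_Y for some Y ⊆ X. -/
/-- Upwards closure `D↑` of a set `D` of states (assumed contained in a single
state-space): `w ∈ D↑` iff some `s ∈ D` lives in a space below `w`'s and `w`
projects onto `s`. -/
def upcl {σ Ω : Type} [CompleteLattice σ] (space : Ω → σ) (proj : Ω → σ → Ω)
    (D : Set Ω) : Set Ω :=
  {w | ∃ s ∈ D, space s ≤ space w ∧ proj w (space s) = s}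

/-- An HMS model: an unawareness frame (a complete lattice `σ` of state-spaces,
each state `w : Ω` lying in the space `space w`; surjective, commuting projections
`proj`; possibility correspondences `Pos` satisfying Confinement, Generalized
Reflexivity, Stationarity, Projections Preserve Ignorance and Projections Preserve
Knowledge) together with an HMS valuation: each atom `p` is assigned the event
`(Vbase p)↑` based in the state-space `Vsp p`. -/
structure HMSModel (Ag At σ Ω : Type) [CompleteLattice σ] where
  nonemptyΩ : Nonempty Ω
  space : Ω → σ
  space_surj : Function.Surjective space
  proj : Ω → σ → Ω
  proj_space : ∀ w S, S ≤ space w → space (proj w S) = S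
  proj_id : ∀ w, proj w (space w) = w
  proj_comm : ∀ w S S', S ≤ S' → S' ≤ space w → proj (proj w S') S = proj w S
  proj_surj : ∀ (s : Ω) (S' : σ), space s ≤ S' → ∃ w, space w = S' ∧ proj w (space s) = s
  Pos : Ag → Ω → Set Ω
  conf : ∀ a w, ∃ S, S ≤ space w ∧ ∀ s ∈ Pos a w, space s = S
  gref : ∀ a w, w ∈ upcl space proj (Pos a w)
  stat : ∀ a w w', w' ∈ Pos a w → Pos a w' = Pos a w
  ppi : ∀ a w S, S ≤ space w →
    upcl space proj (Pos a w) ⊆ upcl space proj (Pos a (proj w S))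
  ppk : ∀ a w S S', S ≤ S' → S' ≤ space w → (∀ s ∈ Pos a w, space s = S') →
    (fun s => proj s S) '' Pos a w = Pos a (proj w S)
  Vbase : At → Set Ω
  Vsp : At → σ
  Vbase_sub : ∀ p, ∀ s ∈ Vbase p, space s = Vsp p

namespace HMSModel

variable {Ag At σ Ω : Type} [CompleteLattice σ]

/-- The event `V_M(p)`, as a set of states: the upwards closure of its base. -/
def Vset (M : HMSModel Ag At σ Ω) (p : At) : Set Ω :=
  upcl M.space M.proj (M.Vbase p)

/-- The event negation `¬V_M(p) = ((S \ D)↑, S)`, as a set of states. -/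
def negVset (M : HMSModel Ag At σ Ω) (p : At) : Set Ω :=
  upcl M.space M.proj ({s | M.space s = M.Vsp p} \ M.Vbase p)

/-- `At(O)`: the atoms that have a defined truth value throughout `O`. -/
def AtO (M : HMSModel Ag At σ Ω) (O : Set Ω) : Set At :=
  {p | O ⊆ M.Vset p ∪ M.negVset p}

/-- `At(S)` for a state-space `S`: the atoms defined throughout `S`. -/
def AtS (M : HMSModel Ag At σ Ω) (S : σ) : Set At :=
  M.AtO {s | M.space s = S}

/-- The maximal state-space `T`; it is the set of worlds `W` of the Kripke model
underlying the `L`-transform of `M`. -/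
abbrev T (M : HMSModel Ag At σ Ω) : Type := {s : Ω // M.space s = ⊤}

/-- The accessibility relation of the `L`-transform of `M`:
`(w, v) ∈ R_a` iff `r^T_{S(Π_a(w))}(v) ∈ Π_a(w)`, where `S(Π_a(w))` is the
state-space containing `Π_a(w)`.  The information cell of `a` at the world
`w_X = (w, X)` of the restriction `K_X` is `I_a(w_X) = {(v, X) : LR a w v}`. -/
def LR (M : HMSModel Ag At σ Ω) (a : Ag) (w v : M.T) : Prop :=
  ∃ S : σ, (∀ s ∈ M.Pos a w.1, M.space s = S) ∧ M.proj v.1 S ∈ M.Pos a w.1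

/-- Defining property of the awareness maps of the `L`-transform of `M`:
`π_a(w_X) = (w, At(S_Y))` where `S_Y` is the state-space with
`S_Y ⊇ Π_a(r^T_{S_X}(w))` and `S_X = min {S : At(S) = X}`. -/
def LpiSpec (M : HMSModel Ag At σ Ω)
    (π : Ag → M.T × Set At → M.T × Set At) : Prop :=
  ∀ (a : Ag) (w : M.T) (X : Set At), ∃ SX SY : σ,
    IsLeast {S : σ | M.AtS S = X} SX ∧
    (M.Pos a (M.proj w.1 SX)).Nonempty ∧
    (∀ s ∈ M.Pos a (M.proj w.1 SX), M.space s = SY) ∧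
    π a (w, X) = (w, M.AtS SY)

/-- The upwards closure of a set of states pulls back along the projections. -/
theorem mem_upcl_of_proj_mem (M : HMSModel Ag At σ Ω) {D : Set Ω} {w : Ω} {S : σ}
    (hS : S ≤ M.space w) (h : M.proj w S ∈ upcl M.space M.proj D) :
    w ∈ upcl M.space M.proj D := by
  obtain ⟨s, hs, hle, hproj⟩ := h
  rw [M.proj_space w S hS] at hle
  rw [M.proj_comm w _ S hle hS] at hproj
  exact ⟨s, hs, hle.trans hS, hproj⟩

/-- Atoms defined in a state-space stay defined in every state-space above it. -/
theorem AtS_mono (M : HMSModel Ag At σ Ω) : Monotone M.AtS := by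
  rintro S S' hS p hp w rfl
  exact (hp (M.proj_space w S hS)).imp (M.mem_upcl_of_proj_mem hS) (M.mem_upcl_of_proj_mem hS)

end HMSModel

/-- Let `L(M)` be the `L`-transform of an HMS model `M`.  Then each
map `π_a` of `L(M)` satisfies property (D): for every world `w_X` of the restriction
lattice of `L(M)`, `π_a(w_X) = w_Y` for some `Y ⊆ X`. -/
theorem Ltransform_pi_downwards
    (Ag At σ Ω : Type) [CompleteLattice σ]
    [Finite Ag] [Nonempty Ag] [Countable At] [Nonempty At]
    (M : HMSModel Ag At σ Ω) (π : Ag → M.T × Set At → M.T × Set At)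
    (hπ : M.LpiSpec π) :
    ∀ (a : Ag) (w : M.T) (X : Set At),
      ∃ Y : Set At, Y ⊆ X ∧ π a (w, X) = (w, Y) := by
  intro a w X
  obtain ⟨SX, SY, hSX, ⟨s, hs⟩, hSY, hπX⟩ := hπ a w X
  refine ⟨M.AtS SY, ?_, hπX⟩
  obtain ⟨S, hle, hS⟩ := M.conf a (M.proj w.1 SX)
  rw [M.proj_space w.1 SX (by rw [w.2]; exact le_top), ← hS s hs, hSY s hs] at hle
  exact (M.AtS_mono hle).trans hSX.1.subset
end

section
/- Let L(M) be the L-transform of an HMS model M. Then each map π_a of L(M) satisfies Introspective Idempotence (II): if π_a(w_X) = w_Y, then for every v_Y in the information cell I_a(w_Y) there exists u_Y ∈ I_a(w_Y) with π_a(v_Y) = u_Y. -/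
namespace HMSModel

variable {Ag At σ Ω : Type} [CompleteLattice σ]

/-- Projecting a state downwards can only lower the space of its possibility set. -/
theorem le_of_mem_Pos_proj (M : HMSModel Ag At σ Ω) {a : Ag} {w s : Ω} {S S' : σ}
    (hS : S ≤ M.space w) (hs : s ∈ M.Pos a w)
    (hS' : ∀ t ∈ M.Pos a (M.proj w S), M.space t = S') : S' ≤ M.space s := by
  obtain ⟨t, ht, hle, -⟩ := M.ppi a w S hS ⟨s, hs, le_rfl, M.proj_id s⟩
  exact hS' t ht ▸ hle

/-- A state that some agent considers possible at `w` has, after projection to a lower space `S`,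
its possibility set inside `S`. -/
theorem space_eq_of_mem_Pos_proj (M : HMSModel Ag At σ Ω) {a : Ag} {w s t : Ω} {S : σ}
    (hs : s ∈ M.Pos a w) (hS : S ≤ M.space s) (ht : t ∈ M.Pos a (M.proj s S)) :
    M.space t = S := by
  have hstat := M.stat a w s hs
  obtain ⟨S₀, -, hS₀⟩ := M.conf a w
  have hsp : ∀ r ∈ M.Pos a s, M.space r = M.space s := fun r hr =>
    (hS₀ r (hstat ▸ hr)).trans (hS₀ s hs).symm
  rw [← M.ppk a s S (M.space s) hS le_rfl hsp] at ht
  obtain ⟨r, hr, rfl⟩ := ht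
  exact M.proj_space r S (hsp r hr ▸ hS)

end HMSModel

/-- Let `L(M)` be the `L`-transform of an HMS model `M`.  Then each
map `π_a` of `L(M)` satisfies Introspective Idempotence (II): if `π_a(w_X) = w_Y`,
then for every `v_Y` in the information cell `I_a(w_Y)` there exists
`u_Y ∈ I_a(w_Y)` with `π_a(v_Y) = u_Y`.  (Membership of `v_Y = (v, Y)` in
`I_a(w_Y)` is `LR a w v`.) -/
theorem Ltransform_pi_introspectiveIdempotence
    (Ag At σ Ω : Type) [CompleteLattice σ]
    [Finite Ag] [Nonempty Ag] [Countable At] [Nonempty At]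
    (M : HMSModel Ag At σ Ω) (π : Ag → M.T × Set At → M.T × Set At)
    (hπ : M.LpiSpec π) :
    ∀ (a : Ag) (w : M.T) (X Y : Set At), π a (w, X) = (w, Y) →
      ∀ v : M.T, M.LR a w v →
        ∃ u : M.T, M.LR a w u ∧ π a (v, Y) = (u, Y) := by
  intro a w X Y hY v hv
  refine ⟨v, hv, ?_⟩
  obtain ⟨S, hS, hvS⟩ := hv
  obtain ⟨SX, SY, -, -, hSY, hπX⟩ := hπ a w X
  obtain ⟨SX', SZ, hmin, ⟨t, ht⟩, hSZ, hπY⟩ := hπ a v Y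
  have hAt : M.AtS SY = Y := congrArg Prod.snd (hπX.symm.trans hY)
  have hspace : M.space (M.proj v.1 S) = S := hS _ hvS
  have hle : SX' ≤ S :=
    (hmin.2 hAt).trans ((M.le_of_mem_Pos_proj (le_top.trans_eq w.2.symm) hvS hSY).trans_eq hspace)
  have hcomm : M.proj (M.proj v.1 S) SX' = M.proj v.1 SX' :=
    M.proj_comm _ _ _ hle (le_top.trans_eq v.2.symm)
  have hZ : SZ = SX' := (hSZ t ht).symm.trans
    (M.space_eq_of_mem_Pos_proj hvS (hspace.symm ▸ hle) (hcomm.symm ▸ ht))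
  rw [hπY, hZ, show M.AtS SX' = Y from hmin.1]
end

section
/- Let L(M) be the L-transform of an HMS model M. Then each map π_a of L(M) satisfies No Surprises (NS): if π_a(w_X) = w_Z, then for all Y ⊆ X, π_a(w_Y) = w_{Y∩Z}. -/
namespace HMSModel

variable {Ag At σ Ω : Type} [CompleteLattice σ]

theorem mem_AtS_iff (M : HMSModel Ag At σ Ω) (S : σ) (p : At) :
    p ∈ M.AtS S ↔ M.Vsp p ≤ S := by
  constructor
  · intro h
    obtain ⟨w, rfl⟩ := M.space_surj S
    rcases h (show M.space w = M.space w from rfl) with ⟨s, hs, hle, -⟩ | ⟨s, hs, hle, -⟩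
    · rwa [M.Vbase_sub p s hs] at hle
    · rwa [show M.space s = M.Vsp p from hs.1] at hle
  · rintro h w rfl
    have hsp := M.proj_space w _ h
    by_cases hb : M.proj w (M.Vsp p) ∈ M.Vbase p
    · exact Or.inl ⟨_, hb, hsp.le.trans h, by rw [hsp]⟩
    · exact Or.inr ⟨_, ⟨hsp, hb⟩, hsp.le.trans h, by rw [hsp]⟩

theorem AtS_inf (M : HMSModel Ag At σ Ω) (S S' : σ) :
    M.AtS (S ⊓ S') = M.AtS S ∩ M.AtS S' := by
  ext p
  simp only [Set.mem_inter_iff, mem_AtS_iff, le_inf_iff]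

theorem Pos_nonempty (M : HMSModel Ag At σ Ω) (a : Ag) (w : Ω) : (M.Pos a w).Nonempty :=
  let ⟨s, hs, _⟩ := M.gref a w
  ⟨s, hs⟩

theorem Pos_space_le (M : HMSModel Ag At σ Ω) {a : Ag} {w : Ω} {U : σ}
    (hU : ∀ s ∈ M.Pos a w, M.space s = U) : U ≤ M.space w := by
  obtain ⟨s, hs, hle, -⟩ := M.gref a w
  rwa [hU s hs] at hle

/-- Projecting a state downwards can only lower the space of its possibility set. -/
theorem Pos_space_mono (M : HMSModel Ag At σ Ω) {a : Ag} {w : Ω} {S U U' : σ}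
    (hS : S ≤ M.space w) (hU : ∀ s ∈ M.Pos a w, M.space s = U)
    (hU' : ∀ s ∈ M.Pos a (M.proj w S), M.space s = U') : U' ≤ U := by
  obtain ⟨s, hs⟩ := M.Pos_nonempty a w
  obtain ⟨t, ht, hle, -⟩ := M.ppi a w S hS ⟨s, hs, le_rfl, M.proj_id s⟩
  rwa [hU' t ht, hU s hs] at hle

/-- Below the space of its possibility set, a projected state has its possibility set in its
own space. -/
theorem Pos_space_proj_of_le (M : HMSModel Ag At σ Ω) {a : Ag} {w : Ω} {S U : σ}
    (hU : ∀ s ∈ M.Pos a w, M.space s = U) (hS : S ≤ U) :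
    ∀ s ∈ M.Pos a (M.proj w S), M.space s = S := by
  rw [← M.ppk a w S U hS (M.Pos_space_le hU) hU]
  rintro _ ⟨s, hs, rfl⟩
  exact M.proj_space s S (hS.trans (hU s hs).ge)

/-- The space of the possibility set of a projected state. -/
theorem Pos_space_proj (M : HMSModel Ag At σ Ω) {a : Ag} {w : Ω} {S U U' : σ}
    (hS : S ≤ M.space w) (hU : ∀ s ∈ M.Pos a w, M.space s = U)
    (hU' : ∀ s ∈ M.Pos a (M.proj w S), M.space s = U') : U' = S ⊓ U := by
  have hsp := M.proj_space w S hS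
  refine le_antisymm (le_inf ((M.Pos_space_le hU').trans hsp.le) (M.Pos_space_mono hS hU hU')) ?_
  refine M.Pos_space_mono (S := S ⊓ U) (inf_le_left.trans hsp.ge) hU' ?_
  rw [M.proj_comm w _ S inf_le_left hS]
  exact M.Pos_space_proj_of_le hU inf_le_right

end HMSModel

/-- Let `L(M)` be the `L`-transform of an HMS model `M`.  Then each
map `π_a` of `L(M)` satisfies No Surprises (NS): if `π_a(w_X) = w_Z`, then for all
`Y ⊆ X`, `π_a(w_Y) = w_{Y ∩ Z}`. -/
theorem Ltransform_pi_noSurprises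
    (Ag At σ Ω : Type) [CompleteLattice σ]
    [Finite Ag] [Nonempty Ag] [Countable At] [Nonempty At]
    (M : HMSModel Ag At σ Ω) (π : Ag → M.T × Set At → M.T × Set At)
    (hπ : M.LpiSpec π) :
    ∀ (a : Ag) (w : M.T) (X Z : Set At), π a (w, X) = (w, Z) →
      ∀ Y : Set At, Y ⊆ X → π a (w, Y) = (w, Y ∩ Z) := by
  intro a w X Z hZ Y hYX
  obtain ⟨SX, U, ⟨hSX, -⟩, -, hU, hπX⟩ := hπ a w X
  obtain ⟨SY, U', ⟨hSY, hmin⟩, -, hU', hπY⟩ := hπ a w Y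
  obtain rfl : M.AtS U = Z := congrArg Prod.snd (hπX.symm.trans hZ)
  have hX : M.AtS SX = X := hSX
  have hY : M.AtS SY = Y := hSY
  have hle : SY ≤ SX := by
    refine (hmin (show M.AtS (SX ⊓ SY) = Y from ?_)).trans inf_le_left
    rw [M.AtS_inf, hX, hY, Set.inter_eq_right.mpr hYX]
  have htop : SX ≤ M.space w.1 := w.2.symm ▸ le_top
  rw [← M.proj_comm w.1 SY SX hle htop] at hU'
  rw [hπY, M.Pos_space_proj (hle.trans (M.proj_space w.1 SX htop).ge) hU hU', M.AtS_inf, hY]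
end

section
/- Let L(M) be the L-transform of an HMS model M, with underlying Kripke model K = (W, R, V). Then for every agent a, the relation R_a is transitive: if (w, v) ∈ R_a and (v, u) ∈ R_a then (w, u) ∈ R_a. -/
/-- Let `L(M)` be the `L`-transform of an HMS model `M`, with
underlying Kripke model `K = (W, R, V)` (so `W = T` and `R_a = LR a`).  Then for
every agent `a`, the relation `R_a` is transitive: if `(w, v) ∈ R_a` and
`(v, u) ∈ R_a` then `(w, u) ∈ R_a`. -/
theorem Ltransform_R_transitive
    (Ag At σ Ω : Type) [CompleteLattice σ]
    [Finite Ag] [Nonempty Ag] [Countable At] [Nonempty At]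
    (M : HMSModel Ag At σ Ω) :
    ∀ (a : Ag) (w v u : M.T), M.LR a w v → M.LR a v u → M.LR a w u := by
  rintro a w v u ⟨S, hS, hv⟩ ⟨S', hS', hu⟩
  have hu_mem : u.1 ∈ upcl M.space M.proj (M.Pos a v.1) := by
    refine ⟨M.proj u.1 S', hu, ?_, ?_⟩
    · rw [u.2]
      exact le_top
    · rw [hS' _ hu]
  have hSv : S ≤ M.space v.1 := by
    rw [v.2]
    exact le_top
  obtain ⟨t, ht, -, htu⟩ := M.ppi a v.1 S hSv hu_mem
  rw [M.stat a w.1 _ hv] at ht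
  refine ⟨S, hS, ?_⟩
  rw [← hS t ht, htu]
  exact ht
end

section
/- Let K be a Kripke lattice model in which every accessibility relation R_a is an equivalence relation, and let H(K) be its H-transform with possibility correspondences Π_a(w_X) = I_a(π_a(w_X)). Then each Π_a satisfies Stationarity: if v ∈ Π_a(w_X) then Π_a(v) = Π_a(w_X). -/
/-- A Kripke model for a set of atoms: a nonempty type of worlds `W`, accessibility
relations `R a` for each agent `a`, and a valuation `V`. -/
structure KripkeModel (Ag At W : Type) where
  nonempty : Nonempty W
  R : Ag → W → W → Prop
  V : At → Set W

/-- Awareness-map properties (D) Downwards, (II) Introspective Idempotence and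
(NS) No Surprises, over the restriction lattice of `K`.  Worlds of the restriction
`K_X` are encoded as pairs `w_X = (w, X)`; the information cell of `a` at `w_X` is
`I_a(w_X) = {(v, X) : K.R a w v}`. -/
def IsAwarenessMap {Ag At W : Type} (K : KripkeModel Ag At W)
    (π : Ag → W × Set At → W × Set At) : Prop :=
  (∀ (a : Ag) (w : W) (X : Set At), ∃ Y : Set At, Y ⊆ X ∧ π a (w, X) = (w, Y)) ∧
  (∀ (a : Ag) (w : W) (X Y : Set At), π a (w, X) = (w, Y) →
    ∀ v : W, K.R a w v → ∃ u : W, K.R a w u ∧ π a (v, Y) = (u, Y)) ∧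
  (∀ (a : Ag) (w : W) (X Z : Set At), π a (w, X) = (w, Z) →
    ∀ Y : Set At, Y ⊆ X → π a (w, Y) = (w, Y ∩ Z))

/-- The possibility correspondence of the `H`-transform of a Kripke lattice model:
`Π_a(w_X) = I_a(π_a(w_X))`, the information cell (in its own restriction) of the
awareness image `π_a(w_X)`. -/
def HPos {Ag At W : Type} (K : KripkeModel Ag At W)
    (π : Ag → W × Set At → W × Set At) (a : Ag) (q : W × Set At) :
    Set (W × Set At) :=
  {v | v.2 = (π a q).2 ∧ K.R a (π a q).1 v.1}

/-- Upwards closure `D↑` of a set `D` (assumed contained in a single state-space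
`W_X`) in the `H`-transform: `q ∈ D↑` iff the projection of `q` to the base
space of `D` lies in `D`, i.e. `(q.1, Y) ∈ D` for some `Y ⊆ q.2`. -/
def Hup {At W : Type} (D : Set (W × Set At)) : Set (W × Set At) :=
  {q | ∃ Y : Set At, Y ⊆ q.2 ∧ (q.1, Y) ∈ D}

/-- Let `K` be a Kripke lattice model in which every accessibility
relation `R_a` is an equivalence relation, and `H(K)` its `H`-transform with
possibility correspondences `Π_a(w_X) = I_a(π_a(w_X))`.  Then each `Π_a` satisfies
Stationarity: if `v ∈ Π_a(w_X)` then `Π_a(v) = Π_a(w_X)`. -/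
theorem Htransform_stationarity
    (Ag At W : Type) [Finite Ag] [Nonempty Ag] [Countable At] [Nonempty At]
    (K : KripkeModel Ag At W) (π : Ag → W × Set At → W × Set At)
    (hπ : IsAwarenessMap K π) (heq : ∀ a : Ag, Equivalence (K.R a)) :
    ∀ (a : Ag) (w : W) (X : Set At) (v : W × Set At),
      v ∈ HPos K π a (w, X) → HPos K π a v = HPos K π a (w, X) := by
  rintro a w X ⟨v, Z⟩ ⟨hZ, hv⟩
  obtain ⟨hD, hII, -⟩ := hπ
  obtain ⟨Y, -, hw⟩ := hD a w X
  simp only [hw] at hZ hv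
  subst hZ
  have hfix : π a (v, Z) = (v, Z) := by
    obtain ⟨Y', -, hY'⟩ := hD a v Z
    obtain ⟨u, -, hu⟩ := hII a w X Z hw v hv
    have hYZ : Y' = Z := congrArg Prod.snd (hY'.symm.trans hu)
    rw [hY', hYZ]
  ext x
  simp only [HPos, Set.mem_ofPred_eq, hw, hfix]
  exact and_congr_right fun _ =>
    ⟨(heq a).trans hv, (heq a).trans ((heq a).symm hv)⟩
end

section
/- Let K be a Kripke lattice model in which every accessibility relation R_a is an equivalence relation, and let H(K) be its H-transform with possibility correspondences Π_a(w_X) = I_a(π_a(w_X)). Then each Π_a satisfies Projections Preserve Ignorance: for every w_X and every Y ⊆ X, (Π_a(w_X))↑ ⊆ (Π_a(w_Y))↑. -/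
/-- Let `K` be a Kripke lattice model in which every accessibility
relation `R_a` is an equivalence relation, and `H(K)` its `H`-transform with
possibility correspondences `Π_a(w_X) = I_a(π_a(w_X))`.  Then each `Π_a` satisfies
Projections Preserve Ignorance: for every `w_X` and every `Y ⊆ X`,
`(Π_a(w_X))↑ ⊆ (Π_a(w_Y))↑`. -/
theorem Htransform_projectionsPreserveIgnorance
    (Ag At W : Type) [Finite Ag] [Nonempty Ag] [Countable At] [Nonempty At]
    (K : KripkeModel Ag At W) (π : Ag → W × Set At → W × Set At)
    (hπ : IsAwarenessMap K π) (heq : ∀ a : Ag, Equivalence (K.R a)) :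
    ∀ (a : Ag) (w : W) (X Y : Set At), Y ⊆ X →
      Hup (HPos K π a (w, X)) ⊆ Hup (HPos K π a (w, Y)) := by
  intro a w X Y hYX
  rintro q ⟨T, hTq, hT, hR⟩
  obtain ⟨Z, -, hZ⟩ := hπ.1 a w X
  have hY := hπ.2.2 a w X Z hZ Y hYX
  simp only [hZ] at hT hR
  subst hT
  exact ⟨Y ∩ T, Set.inter_subset_right.trans hTq, by simp [hY], by simpa [hY] using hR⟩
end

section
/- Let K be a Kripke lattice model in which every accessibility relation R_a is an equivalence relation, and let H(K) be its H-transform with possibility correspondences Π_a(w_X) = I_a(π_a(w_X)). Then each Π_a satisfies Projections Preserve Knowledge: if Z ⊆ Y ⊆ X, w_X ∈ W_X and Π_a(w_X) ⊆ W_Y, then r^{W_Y}_{W_Z}(Π_a(w_X)) = Π_a(w_Z). -/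
/-- Let `K` be a Kripke lattice model in which every accessibility
relation `R_a` is an equivalence relation, and `H(K)` its `H`-transform with
possibility correspondences `Π_a(w_X) = I_a(π_a(w_X))`.  Then each `Π_a` satisfies
Projections Preserve Knowledge: if `Z ⊆ Y ⊆ X`, `w_X ∈ W_X` and `Π_a(w_X) ⊆ W_Y`,
then `r^{W_Y}_{W_Z}(Π_a(w_X)) = Π_a(w_Z)` (projections applied pointwise). -/
theorem Htransform_projectionsPreserveKnowledge
    (Ag At W : Type) [Finite Ag] [Nonempty Ag] [Countable At] [Nonempty At]
    (K : KripkeModel Ag At W) (π : Ag → W × Set At → W × Set At)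
    (hπ : IsAwarenessMap K π) (heq : ∀ a : Ag, Equivalence (K.R a)) :
    ∀ (a : Ag) (w : W) (X Y Z : Set At), Z ⊆ Y → Y ⊆ X →
      HPos K π a (w, X) ⊆ {q : W × Set At | q.2 = Y} →
      (fun q : W × Set At => (q.1, Z)) '' HPos K π a (w, X) = HPos K π a (w, Z) := by
  obtain ⟨down, -, surprise⟩ := hπ
  intro a w X Y Z hZY hYX hsub
  obtain ⟨S, -, hS⟩ := down a w X
  obtain rfl : S = Y := hsub (show (w, S) ∈ HPos K π a (w, X) by
    simp [HPos, hS, (heq a).refl w])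
  have hZ : π a (w, Z) = (w, Z) := by
    rw [surprise a w X S hS Z (hZY.trans hYX), Set.inter_eq_left.mpr hZY]
  ext ⟨v, T⟩
  simp only [HPos, hS, hZ, Set.mem_image, Set.mem_ofPred_eq, Prod.mk.injEq, Prod.exists]
  constructor
  · rintro ⟨u, _, ⟨-, hR⟩, rfl, rfl⟩
    exact ⟨rfl, hR⟩
  · rintro ⟨rfl, hR⟩
    exact ⟨v, S, ⟨rfl, hR⟩, rfl, rfl⟩
end

section
/- The logic Λ_HMS is sound with respect to the class KLM_EQ of Kripke lattice models in which every accessibility relation is an equivalence relation: every theorem of Λ_HMS is valid over KLM_EQ, where a formula φ is valid over a class of models iff in every model of the class, every state at which every atom of φ has a defined truth value (i.e., the state satisfies p or ¬p for each p ∈ At(φ)) satisfies φ. -/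
/-- The language `L` of knowledge: `φ ::= ⊤ | p | ¬φ | φ ∧ φ | K_a φ`. -/
inductive Form (Ag At : Type) : Type
  | top : Form Ag At
  | atom : At → Form Ag At
  | neg : Form Ag At → Form Ag At
  | conj : Form Ag At → Form Ag At → Form Ag At
  | know : Ag → Form Ag At → Form Ag At

/-- `At(φ)`: the set of atoms occurring in `φ`. -/
def Form.atoms {Ag At : Type} : Form Ag At → Set At
  | .top => ∅
  | .atom p => {p}
  | .neg φ => φ.atoms
  | .conj φ ψ => φ.atoms ∪ ψ.atoms
  | .know _ φ => φ.atoms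

/-- Three-valued satisfaction `K, w_X ⊩ φ` over a Kripke lattice model, given by
its base Kripke model `K` and awareness maps `π`.  Worlds of the restriction `K_X`
are pairs `(w, X)`; `(w_X, v_X) ∈ R_{Xa}` iff `(w, v) ∈ R_a`, and `w_X ∈ V_X(p)`
iff `p ∈ X` and `w ∈ V(p)`. -/
def ksat {Ag At W : Type} (K : KripkeModel Ag At W)
    (π : Ag → W × Set At → W × Set At) : Form Ag At → W × Set At → Prop
  | .top, _ => True
  | .atom p, q => p ∈ q.2 ∧ q.1 ∈ K.V p
  | .neg φ, q => φ.atoms ⊆ q.2 ∧ ¬ ksat K π φ q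
  | .conj φ ψ, q => (Form.conj φ ψ).atoms ⊆ q.2 ∧ ksat K π φ q ∧ ksat K π ψ q
  | .know a φ, q => φ.atoms ⊆ q.2 ∧
      ∀ v : W, K.R a (π a q).1 v → ksat K π φ (v, (π a q).2)

/-- Defined disjunction `φ ∨ ψ := ¬(¬φ ∧ ¬ψ)`. -/
def Form.orF {Ag At : Type} (φ ψ : Form Ag At) : Form Ag At :=
  .neg (.conj (.neg φ) (.neg ψ))

/-- Defined implication `φ → ψ := ¬(φ ∧ ¬ψ)`. -/
def Form.impF {Ag At : Type} (φ ψ : Form Ag At) : Form Ag At :=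
  .neg (.conj φ (.neg ψ))

/-- Defined biimplication `φ ↔ ψ`. -/
def Form.iffF {Ag At : Type} (φ ψ : Form Ag At) : Form Ag At :=
  .conj (φ.impF ψ) (ψ.impF φ)

/-- The Modica–Rustichini awareness operator `A_a φ := K_a φ ∨ K_a ¬K_a φ`. -/
def Form.Aw {Ag At : Type} (a : Ag) (φ : Form Ag At) : Form Ag At :=
  Form.orF (.know a φ) (.know a (.neg (.know a φ)))

/-- `φ` is a substitution instance of a propositional tautology: every Boolean
valuation of formulas respecting `⊤`, `¬` and `∧` makes `φ` true. -/
def PropTaut {Ag At : Type} (φ : Form Ag At) : Prop :=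
  ∀ ν : Form Ag At → Prop,
    ν .top → (∀ ψ, ν (.neg ψ) ↔ ¬ ν ψ) →
    (∀ ψ χ, ν (.conj ψ χ) ↔ (ν ψ ∧ ν χ)) → ν φ

/-- Finite conjunction `⋀_{i=1}^n φ_i` of a list of formulas. -/
def conjList {Ag At : Type} : List (Form Ag At) → Form Ag At
  | [] => .top
  | φ :: l => .conj φ (conjList l)

/-- The HMS logic of unawareness `Λ_HMS`: the smallest set of `L`-formulas
containing all substitution instances of propositional tautologies (including `⊤`),
Symmetry, Awareness Conjunction, Awareness Knowledge Reflection, the axioms T and 4,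
and closed under Modus Ponens and RK-Inference. -/
inductive Lhms (Ag At : Type) : Form Ag At → Prop
  | taut {φ : Form Ag At} : PropTaut φ → Lhms Ag At φ
  | awSymmetry (a : Ag) (φ : Form Ag At) :
      Lhms Ag At (Form.iffF (Form.Aw a (.neg φ)) (Form.Aw a φ))
  | awConjunction (a : Ag) (φ ψ : Form Ag At) :
      Lhms Ag At
        (Form.iffF (Form.Aw a (.conj φ ψ)) (.conj (Form.Aw a φ) (Form.Aw a ψ)))
  | awKnowledgeReflection (a b : Ag) (φ : Form Ag At) :
      Lhms Ag At (Form.iffF (Form.Aw a φ) (Form.Aw a (.know b φ)))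
  | axiomT (a : Ag) (φ : Form Ag At) :
      Lhms Ag At (Form.impF (.know a φ) φ)
  | axiom4 (a : Ag) (φ : Form Ag At) :
      Lhms Ag At (Form.impF (.know a φ) (.know a (.know a φ)))
  | mp {φ ψ : Form Ag At} :
      Lhms Ag At (Form.impF φ ψ) → Lhms Ag At φ → Lhms Ag At ψ
  | rkInference (a : Ag) (l : List (Form Ag At)) (φ : Form Ag At)
      (hne : l ≠ []) (hat : ∀ p ∈ φ.atoms, ∃ ψ ∈ l, p ∈ ψ.atoms) :
      Lhms Ag At (Form.impF (conjList l) φ) →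
      Lhms Ag At (Form.impF (conjList (l.map (Form.know a))) (.know a φ))

/-- Two-valued truth at a world of the base model, where `Z a w` is the set of atoms
agent `a` is aware of at `w`. -/
def Form.Holds {Ag At W : Type} (K : KripkeModel Ag At W) (Z : Ag → W → Set At) :
    Form Ag At → W → Prop
  | .top, _ => True
  | .atom p, w => w ∈ K.V p
  | .neg φ, w => ¬ φ.Holds K Z w
  | .conj φ ψ, w => φ.Holds K Z w ∧ ψ.Holds K Z w
  | .know a φ, w => φ.atoms ⊆ Z a w ∧ ∀ v, K.R a w v → φ.Holds K Z v

section

variable {Ag At W : Type} {K : KripkeModel Ag At W} {Z : Ag → W → Set At}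

theorem Form.holds_impF {φ ψ : Form Ag At} {w : W} :
    (φ.impF ψ).Holds K Z w ↔ (φ.Holds K Z w → ψ.Holds K Z w) := by
  simp [Form.impF, Form.Holds]

theorem Form.holds_iffF {φ ψ : Form Ag At} {w : W} :
    (φ.iffF ψ).Holds K Z w ↔ (φ.Holds K Z w ↔ ψ.Holds K Z w) := by
  simp only [Form.iffF, Form.Holds, Form.holds_impF]
  tauto

theorem Form.holds_conjList {l : List (Form Ag At)} {w : W} :
    (conjList l).Holds K Z w ↔ ∀ φ ∈ l, φ.Holds K Z w := by
  induction l with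
  | nil => simp [conjList, Form.Holds]
  | cons φ l ih => simp [conjList, Form.Holds, ih]

theorem Form.holds_Aw (hR : ∀ a, Equivalence (K.R a)) {a : Ag} {φ : Form Ag At} {w : W} :
    (Form.Aw a φ).Holds K Z w ↔ φ.atoms ⊆ Z a w := by
  simp only [Form.Aw, Form.orF, Form.Holds, Form.atoms]
  constructor
  · tauto
  · rintro h ⟨h1, h2⟩
    refine h2 ⟨h, fun v hv hK => h1 ⟨h, fun u hu => hK.2 u ?_⟩⟩
    exact (hR a).trans ((hR a).symm hv) hu

/-- Every theorem of the logic is true at every world of a model whose accessibility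
relations are equivalences and whose awareness sets are constant on information cells. -/
theorem Lhms.holds (hR : ∀ a, Equivalence (K.R a))
    (hZ : ∀ a w v, K.R a w v → Z a w = Z a v) {φ : Form Ag At} (hφ : Lhms Ag At φ) (w : W) :
    φ.Holds K Z w := by
  induction hφ generalizing w with
  | taut h =>
    exact h (fun ψ => ψ.Holds K Z w) trivial (fun _ => Iff.rfl) (fun _ _ => Iff.rfl)
  | awSymmetry a φ =>
    rw [Form.holds_iffF, Form.holds_Aw hR, Form.holds_Aw hR, Form.atoms]
  | awConjunction a φ ψ =>
    rw [Form.holds_iffF, Form.Holds, Form.holds_Aw hR, Form.holds_Aw hR, Form.holds_Aw hR,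
      Form.atoms, Set.union_subset_iff]
  | awKnowledgeReflection a b φ =>
    rw [Form.holds_iffF, Form.holds_Aw hR, Form.holds_Aw hR, Form.atoms]
  | axiomT a φ =>
    exact Form.holds_impF.2 fun h => h.2 w ((hR a).refl w)
  | axiom4 a φ =>
    refine Form.holds_impF.2 fun h => ⟨h.1, fun v hv => ⟨hZ a w v hv ▸ h.1, fun u hu => ?_⟩⟩
    exact h.2 u ((hR a).trans hv hu)
  | mp _ _ ih₁ ih₂ => exact Form.holds_impF.1 (ih₁ w) (ih₂ w)
  | rkInference a l φ _ hat _ ih =>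
    rw [Form.holds_impF, Form.holds_conjList]
    intro h
    have hl : ∀ ψ ∈ l, (Form.know a ψ).Holds K Z w := fun ψ hψ =>
      h _ (List.mem_map_of_mem hψ)
    refine ⟨fun p hp => ?_, fun v hv => ?_⟩
    · obtain ⟨ψ, hψ, hpψ⟩ := hat p hp
      exact (hl ψ hψ).1 hpψ
    · exact Form.holds_impF.1 (ih v) (Form.holds_conjList.2 fun ψ hψ => (hl ψ hψ).2 v hv)

/-- A formula is satisfied at `w_X` iff it is defined there and true at `w`. -/
theorem ksat_iff_holds {π : Ag → W × Set At → W × Set At}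
    (hπ : ∀ a w X, π a (w, X) = (w, X ∩ Z a w)) (hR : ∀ a w, K.R a w w)
    (φ : Form Ag At) (w : W) (X : Set At) :
    ksat K π φ (w, X) ↔ φ.atoms ⊆ X ∧ φ.Holds K Z w := by
  induction φ generalizing w X with
  | top => simp [ksat, Form.atoms, Form.Holds]
  | atom p => simp [ksat, Form.atoms, Form.Holds]
  | neg φ ih =>
    simp only [ksat, Form.atoms, Form.Holds, ih]
    tauto
  | conj φ ψ ih₁ ih₂ =>
    simp only [ksat, Form.atoms, Form.Holds, ih₁, ih₂, Set.union_subset_iff]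
    tauto
  | know a φ ih =>
    simp only [ksat, Form.atoms, Form.Holds, hπ, ih, Set.subset_inter_iff]
    exact ⟨fun h => ⟨h.1, (h.2 w (hR a w)).1.2, fun v hv => (h.2 v hv).2⟩,
      fun h => ⟨h.1, fun v hv => ⟨⟨h.1, h.2.1⟩, h.2.2 v hv⟩⟩⟩

/-- Awareness maps are given by intersection with awareness sets that are constant on
information cells. -/
theorem IsAwarenessMap.exists_awareness_sets {π : Ag → W × Set At → W × Set At}
    (hπ : IsAwarenessMap K π) (hR : ∀ a, Equivalence (K.R a)) :
    ∃ Z : Ag → W → Set At, (∀ a w X, π a (w, X) = (w, X ∩ Z a w)) ∧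
      ∀ a w v, K.R a w v → Z a w = Z a v := by
  obtain ⟨hD, hII, hNS⟩ := hπ
  choose Z _ hZ using fun a w => hD a w Set.univ
  have hinter : ∀ a w X, π a (w, X) = (w, X ∩ Z a w) := fun a w X =>
    hNS a w _ _ (hZ a w) X (Set.subset_univ X)
  have hsub : ∀ a w v, K.R a w v → Z a w ⊆ Z a v := by
    intro a w v hv
    obtain ⟨u, _, hu⟩ := hII a w _ _ (hZ a w) v hv
    rw [hinter] at hu
    exact Set.inter_eq_left.1 (congrArg Prod.snd hu)
  exact ⟨Z, hinter, fun a w v hv => (hsub a w v hv).antisymm (hsub a v w ((hR a).symm hv))⟩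

end

/-- The logic `Λ_HMS` is sound with respect to the class
`KLM_EQ` of Kripke lattice models in which every accessibility relation is an
equivalence relation: every theorem of `Λ_HMS` is valid over `KLM_EQ`, where `φ` is
valid over a class of models iff in every model of the class, every state at which
every atom of `φ` has a defined truth value (i.e. the state satisfies `p` or `¬p`
for each `p ∈ At(φ)`) satisfies `φ`. -/
theorem Lhms_sound_for_KLMeq
    (Ag At : Type) [Finite Ag] [Nonempty Ag] [Countable At] [Nonempty At]
    (φ : Form Ag At) (hφ : Lhms Ag At φ) :
    ∀ (W : Type) (K : KripkeModel Ag At W) (π : Ag → W × Set At → W × Set At),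
      IsAwarenessMap K π → (∀ a : Ag, Equivalence (K.R a)) →
      ∀ (w : W) (X : Set At),
        (∀ p ∈ φ.atoms,
          ksat K π (.atom p) (w, X) ∨ ksat K π (.neg (.atom p)) (w, X)) →
        ksat K π φ (w, X) := by
  intro W K π hπ hR w X hX
  obtain ⟨Z, hinter, hZ⟩ := hπ.exists_awareness_sets hR
  refine (ksat_iff_holds hinter (fun a => (hR a).refl) φ w X).2 ⟨fun p hp => ?_, hφ.holds hR hZ w⟩
  rcases hX p hp with h | h
  · exact h.1
  · exact h.1 rfl
end
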